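/- In the braid group B_N the mixed relation M5 holds: for all 1 ≤ i < j ≤ N−1, σ_j⁻¹ a_{ij} σ_j = a_{ij} a_{i,j+1} a_{ij}⁻¹. -/

import Mathlib

open FreeGroup

namespace BraidPaper

/-- Relators for the Artin braid group on generators `σ_1, …, σ_n`
(so this presents the braid group `B_{n+1}`); the generator with index `k : Fin n`
represents `σ_{k+1}`. -/
def braidRels (n : ℕ) : Set (FreeGroup (Fin n)) :=
  {x | ∃ k l : Fin n, ((k : ℕ) + 2 ≤ (l : ℕ) ∨ (l : ℕ) + 2 ≤ (k : ℕ)) ∧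
      x = of k * of l * (of k)⁻¹ * (of l)⁻¹} ∪
  {x | ∃ k l : Fin n, (l : ℕ) = (k : ℕ) + 1 ∧
      x = of k * of l * of k * (of l)⁻¹ * (of k)⁻¹ * (of l)⁻¹}

/-- The braid group with `n` generators `σ_1, …, σ_n`, i.e. the Artin braid group
`B_{n+1}`.  Thus `B_N = BraidGroup (N-1)`. -/
abbrev BraidGroup (n : ℕ) : Type := PresentedGroup (braidRels n)

/-- The generator `σ_k` (1-based) of `BraidGroup n`, for `1 ≤ k ≤ n`. -/
def sgen (n k : ℕ) : BraidGroup n :=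
  if h : 1 ≤ k ∧ k ≤ n then PresentedGroup.of ⟨k - 1, by omega⟩ else 1

/-- The descending product `σ_{j-1} σ_{j-2} ⋯ σ_{i+1}`. -/
def dprod (n i j : ℕ) : BraidGroup n :=
  ((List.range (j - 1 - i)).map fun t => sgen n (j - 1 - t)).prod

/-- The pure braid generator
`a_{ij} = σ_{j-1} σ_{j-2} ⋯ σ_{i+1} σ_i² σ_{i+1}⁻¹ ⋯ σ_{j-2}⁻¹ σ_{j-1}⁻¹`. -/
def agen (n i j : ℕ) : BraidGroup n := dprod n i j * (sgen n i) ^ 2 * (dprod n i j)⁻¹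

theorem sgen_braid {n k : ℕ} (hk : 1 ≤ k) (hkn : k + 1 ≤ n) :
    sgen n k * sgen n (k + 1) * sgen n k = sgen n (k + 1) * sgen n k * sgen n (k + 1) := by
  let p : Fin n := ⟨k - 1, by omega⟩
  let q : Fin n := ⟨k, by omega⟩
  have hp : sgen n k = PresentedGroup.of p := dif_pos (by omega)
  have hq : sgen n (k + 1) = PresentedGroup.of q := dif_pos (by omega)
  have h : sgen n k * sgen n (k + 1) * sgen n k * (sgen n (k + 1))⁻¹ * (sgen n k)⁻¹ *
      (sgen n (k + 1))⁻¹ = 1 := by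
    rw [hp, hq]
    exact PresentedGroup.one_of_mem (rels := braidRels n)
      (Or.inr ⟨p, q, (Nat.sub_add_cancel hk).symm, rfl⟩)
  rwa [mul_inv_eq_one, mul_inv_eq_iff_eq_mul, mul_inv_eq_iff_eq_mul] at h

theorem sgen_commute {n k l : ℕ} (hkl : k + 2 ≤ l) : Commute (sgen n k) (sgen n l) := by
  unfold sgen
  split_ifs with hk hl
  · let p : Fin n := ⟨k - 1, by omega⟩
    let q : Fin n := ⟨l - 1, by omega⟩
    have h : (PresentedGroup.of p * PresentedGroup.of q * (PresentedGroup.of p)⁻¹ *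
        (PresentedGroup.of q)⁻¹ : BraidGroup n) = 1 :=
      PresentedGroup.one_of_mem (rels := braidRels n)
        (Or.inl ⟨p, q, Or.inl (show k - 1 + 2 ≤ l - 1 by omega), rfl⟩)
    rwa [mul_inv_eq_one, mul_inv_eq_iff_eq_mul] at h
  all_goals simp

theorem dprod_succ {n i j : ℕ} (hij : i < j) :
    dprod n i (j + 1) = sgen n j * dprod n i j := by
  unfold dprod
  rw [show j + 1 - 1 - i = j - 1 - i + 1 by omega, List.range_succ_eq_map, List.map_cons,
    List.prod_cons, List.map_map]
  congr 3
  funext t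
  simp only [Function.comp_apply]
  congr 1
  omega

theorem agen_self_succ (n i : ℕ) : agen n i (i + 1) = sgen n i ^ 2 := by
  simp [agen, dprod]

theorem agen_succ {n i j : ℕ} (hij : i < j) :
    agen n i (j + 1) = sgen n j * agen n i j * (sgen n j)⁻¹ := by
  simp only [agen, dprod_succ hij, mul_inv_rev, mul_assoc]

theorem agen_commute_sgen {n i j l : ℕ} (hij : i < j) (hjl : j + 1 ≤ l) :
    Commute (agen n i j) (sgen n l) := by
  induction j, hij using Nat.le_induction with
  | base =>
    rw [agen_self_succ]
    exact (sgen_commute (by omega)).pow_left 2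
  | succ j hij ih =>
    have h : Commute (sgen n j) (sgen n l) := sgen_commute (by omega)
    rw [agen_succ hij]
    exact (h.mul_left (ih (by omega))).mul_left h.inv_left

/-- The length-four braid relation passes from `(a, t)` to `(t * a * t⁻¹, s)`. -/
theorem braid_four_conj {G : Type*} [Group G] {a s t : G} (hst : t * s * t = s * t * s)
    (has : Commute a s) (hat : a * t * a * t = t * a * t * a) :
    t * a * t⁻¹ * s * (t * a * t⁻¹) * s = s * (t * a * t⁻¹) * s * (t * a * t⁻¹) := by
  have h1 : t⁻¹ * s * t = s * t * s⁻¹ := by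
    rw [mul_assoc, inv_mul_eq_iff_eq_mul, eq_comm, ← mul_assoc, mul_inv_eq_iff_eq_mul,
      ← mul_assoc, hst]
  have h2 : t⁻¹ * s = s * t * s⁻¹ * t⁻¹ := by rw [← h1]; group
  have h3 : s⁻¹ * t⁻¹ * s = t * s⁻¹ * t⁻¹ := by rw [mul_assoc, h2]; group
  have has' : s⁻¹ * a = a * s⁻¹ := has.inv_right.eq.symm
  calc
    _ = t * a * (t⁻¹ * s * t) * a * t⁻¹ * s := by group
    _ = t * (a * s) * t * (s⁻¹ * a) * t⁻¹ * s := by rw [h1]; group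
    _ = t * s * a * t * a * (s⁻¹ * t⁻¹ * s) := by rw [has', has.eq]; group
    _ = t * s * (a * t * a * t) * s⁻¹ * t⁻¹ := by rw [h3]; group
    _ = (t * s * t) * a * t * (a * s⁻¹) * t⁻¹ := by rw [hat]; group
    _ = s * t * (s * a) * t * s⁻¹ * a * t⁻¹ := by rw [hst, ← has']; group
    _ = s * t * a * (s * t * s⁻¹) * a * t⁻¹ := by rw [← has.eq]; group
    _ = _ := by rw [← h1]; group

theorem agen_sgen_braid_four {n i j : ℕ} (hi : 1 ≤ i) (hij : i < j) (hj : j ≤ n) :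
    agen n i j * sgen n j * agen n i j * sgen n j =
      sgen n j * agen n i j * sgen n j * agen n i j := by
  induction j, hij using Nat.le_induction with
  | base =>
    have h := sgen_braid hi hj
    rw [agen_self_succ]
    generalize sgen n i = u at *
    generalize sgen n (i + 1) = s at *
    calc
      _ = u * (u * s * u) * u * s := by simp only [pow_two, mul_assoc]
      _ = u * s * u * (s * u * s) := by rw [h]; simp only [← mul_assoc, h]
      _ = s * u * s * (u * s * u) := by rw [h]
      _ = s * u * (s * u * s) * u := by simp only [mul_assoc]
      _ = _ := by rw [← h]; simp only [pow_two, mul_assoc]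
  | succ j hij ih =>
    rw [agen_succ hij]
    exact braid_four_conj (sgen_braid (by omega) hj) (agen_commute_sgen hij le_rfl)
      (ih (by omega))

/-- Mixed relation M5: `σ_j⁻¹ a_{ij} σ_j = a_{ij} a_{i,j+1} a_{ij}⁻¹` for `1 ≤ i < j ≤ N−1`. -/
theorem statement8 (N : ℕ) (hN : 2 ≤ N) (i j : ℕ)
    (hi : 1 ≤ i) (hij : i < j) (hj : j ≤ N - 1) :
    (sgen (N - 1) j)⁻¹ * agen (N - 1) i j * sgen (N - 1) j =
      agen (N - 1) i j * agen (N - 1) i (j + 1) * (agen (N - 1) i j)⁻¹ := by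
  have h := agen_sgen_braid_four hi hij hj
  rw [agen_succ hij, eq_mul_inv_iff_mul_eq, ← mul_assoc, ← mul_assoc, eq_mul_inv_iff_mul_eq]
  simp only [mul_assoc] at h ⊢
  rw [inv_mul_eq_iff_eq_mul, h]

end BraidPaper
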